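/- Let R = ℚ[t, t⁻¹] and consider the R-linear maps d₂ : R² → R³ whose matrix has columns c₁ = (−t³+t²−1, t³−t+1, −t²+t) and c₂ = (−t³+t−1, t²−t, t³−t²+1), and d₁ : R³ → R given by d₁(p,q,r) = (t−1)(p+q+r). Then d₁ ∘ d₂ = 0, d₂ is injective, R/im(d₁) ≅ ℚ as a ℚ-vector space, and ker(d₁)/im(d₂) is isomorphic as an R-module to R/(Φ₆) ⊕ R/(Φ₁₂), where Φ₆ = t²−t+1 and Φ₁₂ = t⁴−t²+1 are the 6th and 12th cyclotomic polynomials; in particular this torsion module has dimension 6 over ℚ. -/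

import Mathlib

open LaurentPolynomial

/-- The ring `R = ℚ[t, t⁻¹]`. -/
abbrev RQ := LaurentPolynomial ℚ

/-- First column `c₁ = (−t³+t²−1, t³−t+1, −t²+t)` of the differential `d₂`. -/
noncomputable def colOne : RQ × RQ × RQ := (-T 3 + T 2 - 1, T 3 - T 1 + 1, -T 2 + T 1)

/-- Second column `c₂ = (−t³+t−1, t²−t, t³−t²+1)` of the differential `d₂`. -/
noncomputable def colTwo : RQ × RQ × RQ := (-T 3 + T 1 - 1, T 2 - T 1, T 3 - T 2 + 1)

/-- `d₂ : R² → R³`, `(u, v) ↦ u·c₁ + v·c₂`. -/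
noncomputable def dtwo : RQ × RQ →ₗ[RQ] RQ × RQ × RQ :=
  LinearMap.coprod
    (LinearMap.toSpanSingleton RQ (RQ × RQ × RQ) colOne)
    (LinearMap.toSpanSingleton RQ (RQ × RQ × RQ) colTwo)

/-- `d₁ : R³ → R`, `(p, q, r) ↦ (t−1)(p+q+r)`. -/
noncomputable def done : RQ × RQ × RQ →ₗ[RQ] RQ :=
  LinearMap.coprod (LinearMap.toSpanSingleton RQ RQ (T 1 - 1))
    (LinearMap.coprod (LinearMap.toSpanSingleton RQ RQ (T 1 - 1))
      (LinearMap.toSpanSingleton RQ RQ (T 1 - 1)))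

section LaurentQuotient

variable {K : Type*} [Field K]

/-- If `f` has nonzero constant term, then every Laurent polynomial is congruent to a polynomial
modulo `f`. -/
theorem Polynomial.exists_toLaurent_sub_mem_span {f : Polynomial K} (hf : IsCoprime Polynomial.X f)
    (h : LaurentPolynomial K) :
    ∃ g : Polynomial K, Polynomial.toLaurent g - h ∈ Ideal.span {Polynomial.toLaurent f} := by
  obtain ⟨n, h', hh⟩ := LaurentPolynomial.exists_T_pow h
  obtain ⟨a, b, hab⟩ := hf.pow_left (m := n)
  have hT := congrArg Polynomial.toLaurent hab
  simp only [map_add, map_mul, Polynomial.toLaurent_X_pow, map_one] at hT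
  refine ⟨h' * a, Ideal.mem_span_singleton.mpr ⟨-(h * Polynomial.toLaurent b), ?_⟩⟩
  rw [map_mul, hh]
  linear_combination h * hT

theorem Polynomial.toLaurent_mem_span_iff {f : Polynomial K} (hf : IsCoprime Polynomial.X f)
    (g : Polynomial K) :
    Polynomial.toLaurent g ∈ Ideal.span {Polynomial.toLaurent f} ↔ f ∣ g := by
  rw [Ideal.mem_span_singleton]
  refine ⟨fun ⟨h, hg⟩ ↦ ?_, _root_.map_dvd Polynomial.toLaurent⟩
  obtain ⟨n, h', hh⟩ := LaurentPolynomial.exists_T_pow h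
  refine (hf.symm.pow_right (n := n)).dvd_of_dvd_mul_left ⟨h', ?_⟩
  apply Polynomial.toLaurent_injective
  rw [map_mul, map_mul, hh, hg, Polynomial.toLaurent_X_pow]
  ring

theorem LaurentPolynomial.finrank_quotient_span_toLaurent {f : Polynomial K}
    (hf : f.coeff 0 ≠ 0) :
    Module.finrank K (LaurentPolynomial K ⧸ Ideal.span {Polynomial.toLaurent f}) =
      f.natDegree := by
  have hX : IsCoprime Polynomial.X f :=
    (Polynomial.irreducible_X.coprime_iff_not_dvd).mpr (by rwa [Polynomial.X_dvd_iff])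
  let φ : Polynomial K →ₗ[K] LaurentPolynomial K ⧸ Ideal.span {Polynomial.toLaurent f} :=
    (Ideal.Quotient.mkₐ K _).toLinearMap ∘ₗ Polynomial.toLaurentAlg.toLinearMap
  have hker : LinearMap.ker φ = (Ideal.span {f}).restrictScalars K := by
    ext g
    simp [φ, Ideal.Quotient.eq_zero_iff_mem, Polynomial.toLaurent_mem_span_iff hX,
      Ideal.mem_span_singleton]
  have hsurj : Function.Surjective φ := by
    intro y
    obtain ⟨h, rfl⟩ := Ideal.Quotient.mk_surjective y
    obtain ⟨g, hg⟩ := Polynomial.exists_toLaurent_sub_mem_span hX h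
    exact ⟨g, Ideal.Quotient.eq.mpr hg⟩
  have e := (Submodule.quotEquivOfEq _ _ hker).symm.trans (φ.quotKerEquivOfSurjective hsurj)
  rw [← e.finrank_eq]
  exact finrank_quotient_span_eq_natDegree

end LaurentQuotient

theorem T_two : (T 2 : RQ) = T 1 ^ 2 := by
  rw [T_pow]; norm_num

theorem T_three : (T 3 : RQ) = T 1 ^ 3 := by
  rw [T_pow]; norm_num

theorem T_four : (T 4 : RQ) = T 1 ^ 4 := by
  rw [T_pow]; norm_num

theorem toLaurent_cyclotomic_six :
    (Polynomial.cyclotomic 6 ℚ).toLaurent = (T 2 - T 1 + 1 : RQ) := by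
  simp [Polynomial.cyclotomic_six]

theorem cyclotomic_twelve :
    Polynomial.cyclotomic 12 ℚ = Polynomial.X ^ 4 - Polynomial.X ^ 2 + 1 := by
  rw [show 12 = 6 * 2 from rfl, ← Polynomial.cyclotomic_expand_eq_cyclotomic Nat.prime_two
    (by norm_num), Polynomial.cyclotomic_six]
  simp [← pow_mul]

theorem toLaurent_cyclotomic_twelve :
    (Polynomial.cyclotomic 12 ℚ).toLaurent = (T 4 - T 2 + 1 : RQ) := by
  simp [cyclotomic_twelve]

theorem finrank_quotient_toLaurent_cyclotomic {n : ℕ} (hn : 1 < n) :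
    Module.finrank ℚ (RQ ⧸ Ideal.span {(Polynomial.cyclotomic n ℚ).toLaurent}) = n.totient := by
  rw [LaurentPolynomial.finrank_quotient_span_toLaurent
    (by simp [Polynomial.cyclotomic_coeff_zero ℚ hn]), Polynomial.natDegree_cyclotomic]

theorem dtwo_apply (u v : RQ) : dtwo (u, v) = u • colOne + v • colTwo := by
  simp [dtwo]

theorem done_apply (p q r : RQ) : done (p, q, r) = (T 1 - 1) * (p + q + r) := by
  simp [done]; ring

theorem T_one_sub_one_ne_zero : (T 1 - 1 : RQ) ≠ 0 := by
  have h : (T 1 - 1 : RQ) = Polynomial.toLaurent (Polynomial.X - Polynomial.C 1) := by simp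
  rw [h, Polynomial.toLaurent_ne_zero]
  exact Polynomial.X_sub_C_ne_zero 1

theorem mem_ker_done {p q r : RQ} : (p, q, r) ∈ LinearMap.ker done ↔ p + q + r = 0 := by
  rw [LinearMap.mem_ker, done_apply, mul_eq_zero, or_iff_right T_one_sub_one_ne_zero]

/-- The linear form `(p, q, r) ↦ (t² - t)p + (t³ - t + 1)q`, which vanishes on `c₂` and sends `c₁`
to `Φ₆Φ₁₂`. -/
noncomputable def cokernelForm : RQ × RQ × RQ →ₗ[RQ] RQ :=
  LinearMap.coprod (LinearMap.toSpanSingleton RQ RQ (T 2 - T 1))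
    (LinearMap.coprod (LinearMap.toSpanSingleton RQ RQ (T 3 - T 1 + 1)) 0)

theorem cokernelForm_apply (p q r : RQ) :
    cokernelForm (p, q, r) = (T 2 - T 1) * p + (T 3 - T 1 + 1) * q := by
  simp [cokernelForm]; ring

theorem cokernelForm_dtwo (u v : RQ) :
    cokernelForm (dtwo (u, v)) = (T 2 - T 1 + 1) * (T 4 - T 2 + 1) * u := by
  simp only [dtwo_apply, colOne, colTwo, Prod.smul_mk, Prod.mk_add_mk, cokernelForm_apply,
    smul_eq_mul, T_two, T_three, T_four]
  ring

theorem done_comp_dtwo : done.comp dtwo = 0 := by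
  refine LinearMap.ext fun ⟨u, v⟩ ↦ ?_
  simp only [LinearMap.comp_apply, dtwo_apply, colOne, colTwo, Prod.smul_mk, Prod.mk_add_mk,
    done_apply, smul_eq_mul, LinearMap.zero_apply]
  ring

theorem cyclotomic_factors_ne_zero : (T 2 - T 1 + 1 : RQ) * (T 4 - T 2 + 1) ≠ 0 := by
  rw [← toLaurent_cyclotomic_six, ← toLaurent_cyclotomic_twelve]
  exact mul_ne_zero (Polynomial.toLaurent_ne_zero.mpr (Polynomial.cyclotomic_ne_zero 6 ℚ))
    (Polynomial.toLaurent_ne_zero.mpr (Polynomial.cyclotomic_ne_zero 12 ℚ))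

theorem ker_dtwo : LinearMap.ker dtwo = ⊥ := by
  rw [LinearMap.ker_eq_bot']
  rintro ⟨u, v⟩ h
  have hu : u = 0 := by
    have := cokernelForm_dtwo u v
    rw [h, map_zero, eq_comm, mul_eq_zero] at this
    exact this.resolve_left cyclotomic_factors_ne_zero
  subst hu
  simp only [dtwo_apply, colOne, colTwo, Prod.smul_mk, Prod.mk_add_mk, smul_eq_mul, Prod.mk_eq_zero,
    zero_mul, zero_add] at h
  have hv : v = 0 := by
    have h1 := h.1
    have h2 := h.2.1
    simp only [T_two, T_three] at h1 h2
    linear_combination -h1 - (T 1 + 1) * h2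
  rw [hv]; rfl

theorem mem_range_dtwo_iff {p q r : RQ} (h : p + q + r = 0) :
    (p, q, r) ∈ LinearMap.range dtwo ↔
      (T 2 - T 1 + 1) * (T 4 - T 2 + 1) ∣ cokernelForm (p, q, r) := by
  constructor
  · rintro ⟨⟨u, v⟩, huv⟩
    exact ⟨u, by rw [← huv, cokernelForm_dtwo]⟩
  · rintro ⟨s, hs⟩
    refine ⟨(s, T 4 * s - (p + (T 1 + 1) * q)), ?_⟩
    obtain rfl : r = -p - q := by linear_combination h
    rw [cokernelForm_apply] at hs
    simp only [T_two, T_three, T_four] at hs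
    simp only [dtwo_apply, colOne, colTwo, Prod.smul_mk, Prod.mk_add_mk, smul_eq_mul,
      T_two, T_three, T_four, Prod.mk.injEq]
    refine ⟨?_, ?_, ?_⟩
    · linear_combination (T 1 + 1) * hs
    · linear_combination -hs
    · linear_combination -T 1 * hs

theorem isCoprime_cyclotomic_factors :
    IsCoprime (T 2 - T 1 + 1 : RQ) (T 4 - T 2 + 1) := by
  have h := (Polynomial.cyclotomic.isCoprime_rat (n := 6) (m := 12) (by norm_num)).map
    (Polynomial.toLaurent (R := ℚ))
  rwa [toLaurent_cyclotomic_six, toLaurent_cyclotomic_twelve] at h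

/-- The map `ker d₁ → R/(Φ₆) × R/(Φ₁₂)` induced by `cokernelForm`. -/
noncomputable def kerToProd : LinearMap.ker done →ₗ[RQ]
    (RQ ⧸ Ideal.span {(T 2 - T 1 + 1 : RQ)}) × (RQ ⧸ Ideal.span {(T 4 - T 2 + 1 : RQ)}) :=
  (LinearMap.prod (Submodule.mkQ _) (Submodule.mkQ _)) ∘ₗ cokernelForm ∘ₗ
    (LinearMap.ker done).subtype

theorem ker_kerToProd :
    LinearMap.ker kerToProd = (LinearMap.range dtwo).comap (LinearMap.ker done).subtype := by
  ext ⟨⟨p, q, r⟩, h⟩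
  rw [Submodule.mem_comap, Submodule.subtype_apply, mem_range_dtwo_iff (mem_ker_done.mp h)]
  have hdvd : ∀ z : RQ, (T 2 - T 1 + 1) * (T 4 - T 2 + 1) ∣ z ↔
      (T 2 - T 1 + 1 : RQ) ∣ z ∧ (T 4 - T 2 + 1 : RQ) ∣ z := fun z ↦
    ⟨fun hz ↦ ⟨dvd_of_mul_right_dvd hz, dvd_of_mul_left_dvd hz⟩,
      fun hz ↦ IsCoprime.mul_dvd isCoprime_cyclotomic_factors hz.1 hz.2⟩
  rw [hdvd]
  simp [kerToProd, Ideal.Quotient.eq_zero_iff_dvd]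

theorem kerToProd_surjective : Function.Surjective kerToProd := by
  rintro ⟨x, y⟩
  obtain ⟨x, rfl⟩ := Submodule.mkQ_surjective _ x
  obtain ⟨y, rfl⟩ := Submodule.mkQ_surjective _ y
  obtain ⟨a, b, hab⟩ := isCoprime_cyclotomic_factors
  set z := x + a * (T 2 - T 1 + 1) * (y - x) with hz
  have hform : cokernelForm (-(T 1 + 1) * z, z, T 1 * z) = z := by
    simp only [cokernelForm_apply, T_two, T_three]
    ring
  refine ⟨⟨(-(T 1 + 1) * z, z, T 1 * z), mem_ker_done.mpr (by ring)⟩, ?_⟩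
  simp only [kerToProd, LinearMap.comp_apply, Submodule.subtype_apply, hform]
  refine Prod.ext ((Submodule.Quotient.eq _).mpr ?_) ((Submodule.Quotient.eq _).mpr ?_) <;>
    rw [Ideal.mem_span_singleton]
  · exact ⟨a * (y - x), by rw [hz]; ring⟩
  · exact ⟨b * (x - y), by rw [hz]; linear_combination (y - x) * hab⟩

/-- The isomorphism `ker d₁ / im d₂ ≅ R/(Φ₆) × R/(Φ₁₂)`. -/
noncomputable def homologyEquiv : (LinearMap.ker done ⧸
      (LinearMap.range dtwo).comap (LinearMap.ker done).subtype) ≃ₗ[RQ]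
    (RQ ⧸ Ideal.span {(T 2 - T 1 + 1 : RQ)}) × (RQ ⧸ Ideal.span {(T 4 - T 2 + 1 : RQ)}) :=
  (Submodule.quotEquivOfEq _ _ ker_kerToProd.symm).trans
    (kerToProd.quotKerEquivOfSurjective kerToProd_surjective)

theorem finrank_homology : Module.finrank ℚ (LinearMap.ker done ⧸
    (LinearMap.range dtwo).comap (LinearMap.ker done).subtype) = 6 := by
  have h₆ : Module.finrank ℚ (RQ ⧸ Ideal.span {(T 2 - T 1 + 1 : RQ)}) = 2 := by
    rw [← toLaurent_cyclotomic_six, finrank_quotient_toLaurent_cyclotomic (by norm_num)]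
    decide
  have h₁₂ : Module.finrank ℚ (RQ ⧸ Ideal.span {(T 4 - T 2 + 1 : RQ)}) = 4 := by
    rw [← toLaurent_cyclotomic_twelve, finrank_quotient_toLaurent_cyclotomic (by norm_num)]
    decide
  have := Module.finite_of_finrank_pos (h₆ ▸ two_pos)
  have := Module.finite_of_finrank_pos (h₁₂ ▸ four_pos)
  rw [(homologyEquiv.restrictScalars ℚ).finrank_eq, Module.finrank_prod, h₆, h₁₂]

theorem range_done : LinearMap.range done = Ideal.span {(T 1 - 1 : RQ)} := by
  ext x
  rw [Ideal.mem_span_singleton]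
  constructor
  · rintro ⟨⟨p, q, r⟩, rfl⟩
    exact ⟨_, done_apply p q r⟩
  · rintro ⟨y, rfl⟩
    exact ⟨(y, 0, 0), by simp [done_apply]⟩

theorem finrank_quotient_range_done : Module.finrank ℚ (RQ ⧸ LinearMap.range done) = 1 := by
  have h : (T 1 - 1 : RQ) = Polynomial.toLaurent (Polynomial.X - Polynomial.C 1) := by simp
  rw [range_done, h, LaurentPolynomial.finrank_quotient_span_toLaurent (by simp),
    Polynomial.natDegree_X_sub_C]

/-- `d₁ ∘ d₂ = 0`, `d₂` is injective, `R/im(d₁) ≅ ℚ` as a `ℚ`-vector space, and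
`ker(d₁)/im(d₂) ≅ R/(Φ₆) ⊕ R/(Φ₁₂)` as `R`-modules, where `Φ₆ = t²−t+1` and `Φ₁₂ = t⁴−t²+1`
are the 6th and 12th cyclotomic polynomials; this torsion module has dimension 6 over `ℚ`. -/
theorem milnor_fiber_complex_G12 :
    (∀ u v : RQ, dtwo (u, v) = u • colOne + v • colTwo) ∧
    (∀ p q r : RQ, done (p, q, r) = (T 1 - 1) * (p + q + r)) ∧
    done.comp dtwo = 0 ∧
    LinearMap.ker dtwo = ⊥ ∧
    Nonempty ((RQ ⧸ LinearMap.range done) ≃ₗ[ℚ] ℚ) ∧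
    ((Polynomial.cyclotomic 6 ℚ).toLaurent = (T 2 - T 1 + 1 : RQ)) ∧
    ((Polynomial.cyclotomic 12 ℚ).toLaurent = (T 4 - T 2 + 1 : RQ)) ∧
    Nonempty ((LinearMap.ker done ⧸
        (LinearMap.range dtwo).comap (LinearMap.ker done).subtype) ≃ₗ[RQ]
      (RQ ⧸ Ideal.span {(T 2 - T 1 + 1 : RQ)}) × (RQ ⧸ Ideal.span {(T 4 - T 2 + 1 : RQ)})) ∧
    Module.finrank ℚ (LinearMap.ker done ⧸
        (LinearMap.range dtwo).comap (LinearMap.ker done).subtype) = 6 := by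
  have := Module.finite_of_finrank_pos (finrank_quotient_range_done ▸ one_pos)
  exact ⟨dtwo_apply, done_apply, done_comp_dtwo, ker_dtwo,
    ⟨LinearEquiv.ofFinrankEq _ _ (by rw [finrank_quotient_range_done, Module.finrank_self])⟩,
    toLaurent_cyclotomic_six, toLaurent_cyclotomic_twelve, ⟨homologyEquiv⟩, finrank_homology⟩
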